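/- For every T > 0 there exists a constant C > 0, depending only on T, φ and γ₀, such that for all real numbers 0 ≤ s < t ≤ T ≤ R, ∫_{[s,t]²} γ₀(r − v) ( ∫_ℝ ℓ_R(ξ) φ(ξ) e^{−((t−r)+(t−v))ξ²/2} dξ ) dr dv ≤ C (t − s). -/

import Mathlib

open MeasureTheory Real

lemma sin_sq_div_sq_le (x : ℝ) : sin x ^ 2 / x ^ 2 ≤ 2 * (1 + x ^ 2)⁻¹ := by
  rcases eq_or_ne x 0 with rfl | hx
  · simp
  have hx2 : 0 < x ^ 2 := by positivity
  have h1 : sin x ^ 2 ≤ x ^ 2 := sq_le_sq.mpr abs_sin_le_abs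
  have h2 : sin x ^ 2 ≤ 1 := sin_sq_le_one x
  rw [← div_eq_mul_inv, div_le_div_iff₀ hx2 (by positivity)]
  nlinarith [mul_le_mul_of_nonneg_right h2 hx2.le]

lemma fejer_kernel_le {R : ℝ} (hR : 0 < R) (ξ : ℝ) :
    sin (R * ξ) ^ 2 / (π * R * ξ ^ 2) ≤ 2 * R / π * (1 + (R * ξ) ^ 2)⁻¹ := by
  have h := mul_le_mul_of_nonneg_left (sin_sq_div_sq_le (R * ξ))
    (div_nonneg hR.le pi_pos.le)
  calc sin (R * ξ) ^ 2 / (π * R * ξ ^ 2) = R / π * (sin (R * ξ) ^ 2 / (R * ξ) ^ 2) := by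
        rcases eq_or_ne ξ 0 with rfl | hξ
        · simp
        · field_simp
    _ ≤ R / π * (2 * (1 + (R * ξ) ^ 2)⁻¹) := h
    _ = _ := by ring

lemma integrable_cauchy_kernel {R : ℝ} (hR : 0 < R) :
    Integrable fun ξ : ℝ => 2 * R / π * (1 + (R * ξ) ^ 2)⁻¹ :=
  (integrable_inv_one_add_sq.comp_mul_left' hR.ne').const_mul _

lemma integral_cauchy_kernel {R : ℝ} (hR : 0 < R) :
    ∫ ξ : ℝ, 2 * R / π * (1 + (R * ξ) ^ 2)⁻¹ = 2 := by
  rw [integral_const_mul, Measure.integral_comp_mul_left (fun x : ℝ => (1 + x ^ 2)⁻¹),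
    integral_univ_inv_one_add_sq, abs_of_pos (inv_pos.mpr hR), smul_eq_mul]
  field_simp

/-- Fejér averages of a function that is small at the origin and integrable against `ξ⁻²` away
from it are bounded uniformly in `R ≥ T`. -/
lemma exists_lintegral_fejer_kernel_mul_le (φ : ℝ → ℝ) (hφnn : ∀ x, 0 ≤ φ x)
    (hφcont : ContinuousAt φ 0) (hφ0 : φ 0 = 0)
    (hφint : ∀ δ : ℝ, 0 < δ → IntegrableOn (fun ξ => φ ξ / ξ ^ 2) {ξ : ℝ | δ ≤ |ξ|})
    {T : ℝ} (hT : 0 < T) :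
    ∃ M : ℝ, 0 ≤ M ∧ ∀ R : ℝ, T ≤ R →
      ∫⁻ ξ : ℝ, ENNReal.ofReal (sin (R * ξ) ^ 2 / (π * R * ξ ^ 2) * φ ξ) ≤ ENNReal.ofReal M := by
  obtain ⟨δ, hδ, hφδ⟩ := Metric.continuousAt_iff.mp hφcont 1 one_pos
  set A : Set ℝ := {ξ : ℝ | δ ≤ |ξ|}
  have hA : MeasurableSet A := measurableSet_le measurable_const measurable_norm
  set g : ℝ → ℝ := A.indicator fun ξ => φ ξ / ξ ^ 2
  have hg0 : ∀ ξ, 0 ≤ g ξ := fun ξ =>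
    Set.indicator_nonneg (fun ξ _ => div_nonneg (hφnn ξ) (sq_nonneg ξ)) ξ
  have hgi : Integrable g := (integrable_indicator_iff hA).mpr (hφint δ hδ)
  refine ⟨2 + (π * T)⁻¹ * ∫ ξ, g ξ, ?_, fun R hTR => ?_⟩
  · have : 0 ≤ ∫ ξ, g ξ := integral_nonneg hg0
    positivity
  have hR : 0 < R := hT.trans_le hTR
  have hbound : ∀ ξ, sin (R * ξ) ^ 2 / (π * R * ξ ^ 2) * φ ξ ≤
      2 * R / π * (1 + (R * ξ) ^ 2)⁻¹ + (π * T)⁻¹ * g ξ := by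
    intro ξ
    by_cases hξ : ξ ∈ A
    · have hgξ : g ξ = φ ξ / ξ ^ 2 := Set.indicator_of_mem hξ _
      have hle : sin (R * ξ) ^ 2 / (π * R * ξ ^ 2) * φ ξ ≤ (π * T)⁻¹ * g ξ := by
        calc sin (R * ξ) ^ 2 / (π * R * ξ ^ 2) * φ ξ
            = sin (R * ξ) ^ 2 * (π * R)⁻¹ * g ξ := by
              rw [hgξ, div_eq_mul_inv, div_eq_mul_inv, mul_inv]; ring
          _ ≤ 1 * (π * T)⁻¹ * g ξ := by
              gcongr
              · exact hg0 ξ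
              · exact sin_sq_le_one _
          _ = _ := by ring
      have : 0 ≤ 2 * R / π * (1 + (R * ξ) ^ 2)⁻¹ := by positivity
      linarith
    · have hφ1 : φ ξ ≤ 1 := by
        have hlt : dist ξ 0 < δ := by simpa [A] using hξ
        have h := hφδ hlt
        rw [hφ0, Real.dist_eq, sub_zero] at h
        exact (le_abs_self _).trans h.le
      have hgξ : g ξ = 0 := Set.indicator_of_notMem hξ _
      rw [hgξ, mul_zero, add_zero]
      exact (mul_le_of_le_one_right (by positivity) hφ1).trans (fejer_kernel_le hR ξ)
  have hi := integrable_cauchy_kernel hR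
  have hgi' : Integrable fun ξ => (π * T)⁻¹ * g ξ := hgi.const_mul _
  refine (lintegral_mono fun ξ => ENNReal.ofReal_le_ofReal (hbound ξ)).trans ?_
  have hsum0 : ∀ ξ, 0 ≤ 2 * R / π * (1 + (R * ξ) ^ 2)⁻¹ + (π * T)⁻¹ * g ξ := fun ξ => by
    have := hg0 ξ
    positivity
  have hsum := ofReal_integral_eq_lintegral_ofReal (hi.add hgi')
    (Filter.Eventually.of_forall hsum0)
  simp only [Pi.add_apply] at hsum
  rw [← hsum, integral_add hi hgi', integral_cauchy_kernel hR, integral_const_mul]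

lemma setLIntegral_comp_sub_left_le (f : ℝ → ENNReal) {s t r T : ℝ} (hs : 0 ≤ s) (ht : t ≤ T)
    (hr : r ∈ Set.Icc s t) :
    ∫⁻ v in Set.Icc s t, f (r - v) ≤ ∫⁻ x in Set.Icc (-T) T, f x := by
  rw [← lintegral_indicator measurableSet_Icc, ← lintegral_indicator measurableSet_Icc,
    ← lintegral_sub_left_eq_self ((Set.Icc (-T) T).indicator f) r]
  refine lintegral_mono fun v => ?_
  by_cases hv : v ∈ Set.Icc s t
  · have : r - v ∈ Set.Icc (-T) T :=
      ⟨by linarith [hr.1, hv.2], by linarith [hr.2, hv.1]⟩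
    simp [hv, this]
  · simp [hv]

/-- For every T > 0 there is a constant C > 0 such that for all 0 ≤ s < t ≤ T ≤ R,
∫_{[s,t]²} γ₀(r−v) ( ∫_ℝ ℓ_R(ξ) φ(ξ) e^{−((t−r)+(t−v))ξ²/2} dξ ) dr dv ≤ C (t − s),
where ℓ_R(ξ) = sin²(Rξ)/(π R ξ²). -/
theorem second_increment_bound (φ : ℝ → ℝ) (hφm : Measurable φ) (hφnn : ∀ x, 0 ≤ φ x)
    (hφcont : ContinuousAt φ 0) (hφ0 : φ 0 = 0)
    (hφint : ∀ δ : ℝ, 0 < δ →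
      MeasureTheory.IntegrableOn (fun ξ => φ ξ / ξ ^ 2) {ξ : ℝ | δ ≤ |ξ|})
    (γ₀ : ℝ → ℝ) (hγm : Measurable γ₀) (hγnn : ∀ x, 0 ≤ γ₀ x)
    (hγloc : MeasureTheory.LocallyIntegrable γ₀) :
    ∀ T : ℝ, 0 < T → ∃ C : ℝ, 0 < C ∧ ∀ s t R : ℝ, 0 ≤ s → s < t → t ≤ T → T ≤ R →
      (∫⁻ r in Set.Icc s t, ∫⁻ v in Set.Icc s t,
          ENNReal.ofReal (γ₀ (r - v)) *
            ∫⁻ ξ : ℝ, ENNReal.ofReal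
              ((Real.sin (R * ξ) ^ 2 / (Real.pi * R * ξ ^ 2)) * φ ξ *
                Real.exp (-((t - r) + (t - v)) * ξ ^ 2 / 2)))
        ≤ ENNReal.ofReal (C * (t - s)) := by
  intro T hT
  obtain ⟨M, hM, hMle⟩ :=
    exists_lintegral_fejer_kernel_mul_le φ hφnn hφcont hφ0 hφint hT
  set Γ : ℝ := ∫ x in Set.Icc (-T) T, γ₀ x
  have hΓ : 0 ≤ Γ := integral_nonneg hγnn
  have hΓeq : ∫⁻ x in Set.Icc (-T) T, ENNReal.ofReal (γ₀ x) = ENNReal.ofReal Γ :=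
    (ofReal_integral_eq_lintegral_ofReal (hγloc.integrableOn_isCompact isCompact_Icc)
      (Filter.Eventually.of_forall hγnn)).symm
  refine ⟨Γ * M + 1, by positivity, fun s t R hs hst ht hTR => ?_⟩
  have hR : 0 < R := hT.trans_le hTR
  calc _ ≤ ∫⁻ r in Set.Icc s t, ENNReal.ofReal (Γ * M) := by
        refine setLIntegral_mono measurable_const fun r hr => ?_
        calc _ ≤ ∫⁻ v in Set.Icc s t, ENNReal.ofReal (γ₀ (r - v)) * ENNReal.ofReal M := by
              refine setLIntegral_mono (by fun_prop) fun v hv => ?_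
              gcongr
              refine (lintegral_mono fun ξ => ENNReal.ofReal_le_ofReal ?_).trans (hMle R hTR)
              refine mul_le_of_le_one_right (mul_nonneg (by positivity) (hφnn ξ)) ?_
              rw [exp_le_one_iff]
              nlinarith [hr.2, hv.2, mul_nonneg (add_nonneg (sub_nonneg.mpr hr.2)
                (sub_nonneg.mpr hv.2)) (sq_nonneg ξ)]
          _ ≤ ENNReal.ofReal Γ * ENNReal.ofReal M := by
              rw [lintegral_mul_const _ (by fun_prop), ← hΓeq]
              exact mul_le_mul_left
                (setLIntegral_comp_sub_left_le (fun x => ENNReal.ofReal (γ₀ x)) hs ht hr) _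
          _ = ENNReal.ofReal (Γ * M) := (ENNReal.ofReal_mul hΓ).symm
    _ = ENNReal.ofReal (Γ * M * (t - s)) := by
        rw [setLIntegral_const, Real.volume_Icc, ← ENNReal.ofReal_mul (by positivity)]
    _ ≤ ENNReal.ofReal ((Γ * M + 1) * (t - s)) := by
        refine ENNReal.ofReal_le_ofReal ?_
        nlinarith
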